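/- arXiv:2111.12362 — 4 statements merged into one kernel-verified Lean document; each statement's English description precedes it below -/
import Mathlib

section
/- Let G be a finite edge-colored graph with vertex set V; for each edge color c let E_c denote the set of edges of color c and A_{G_c} the 0/1 adjacency matrix of the edges of color c. Let A be a unital C*-algebra and u = (u_{ij})_{i,j∈V} a magic unitary over A. Then A_{G_c} u = u A_{G_c} holds for every edge color c if and only if for all i,j,k,l ∈ V and every edge color c one has u_{ij}u_{kl} = 0 whenever (i,k) ∈ E_c and (j,l) ∉ E_c, and u_{ij}u_{kl} = 0 whenever (i,k) ∉ E_c and (j,l) ∈ E_c. -/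
open scoped BigOperators

/-- A magic unitary over a ring with star: every entry is a projection and
every row and column sums to `1`. -/
def IsMagicUnitary {I J A : Type*} [Fintype I] [Fintype J] [Ring A] [StarRing A]
    (u : I → J → A) : Prop :=
  (∀ i j, star (u i j) = u i j) ∧ (∀ i j, u i j * u i j = u i j) ∧
    (∀ i, ∑ j, u i j = 1) ∧ (∀ j, ∑ i, u i j = 1)

section SelfAdjoint

variable {A : Type*} [NormedRing A] [StarRing A] [CStarRing A]

theorem IsSelfAdjoint.norm_le_one_of_pow_norm_le {x : A} (hx : IsSelfAdjoint x) {K : ℝ}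
    (hK : ∀ n : ℕ, ‖x ^ (n + 1)‖ ≤ K) : ‖x‖ ≤ 1 := by
  by_contra! h
  obtain ⟨m, hm⟩ := pow_unbounded_of_one_lt K h
  have h₁ : ‖x‖ ^ m ≤ ‖x‖ ^ 2 ^ m := pow_le_pow_right₀ h.le Nat.lt_two_pow_self.le
  have h₂ := hK (2 ^ m - 1)
  rw [Nat.sub_add_cancel Nat.one_le_two_pow, hx.norm_pow_two_pow] at h₂
  linarith

theorem IsStarProjection.norm_one_sub_mul_mul_le {p q : A} (hp : IsStarProjection p)
    (hq : IsStarProjection q) : ‖1 - p * q * p‖ ≤ 1 := by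
  have hpp : p * p = p := hp.isIdempotentElem.eq
  set y := p * (1 - q) * p with hy
  have hpy : (1 - p) * y = 0 := by
    simp only [hy, ← mul_assoc, sub_mul, one_mul, hpp, sub_self, zero_mul]
  have hyp : y * (1 - p) = 0 := by
    simp only [hy, mul_assoc, mul_sub, mul_one, hpp, sub_self]
  have hx : 1 - p * q * p = (1 - p) + y := by
    simp only [hy, mul_sub, sub_mul, mul_one, hpp]; abel
  have hsa : IsSelfAdjoint (1 - p * q * p) := by
    simp [IsSelfAdjoint, hp.isSelfAdjoint.star_eq, hq.isSelfAdjoint.star_eq, mul_assoc]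
  have hy1 : ‖y‖ ≤ 1 := by
    have h1 := IsStarProjection.norm_le p hp
    have h2 := IsStarProjection.norm_le (1 - q) hq.one_sub
    calc ‖y‖ ≤ ‖p * (1 - q)‖ * ‖p‖ := norm_mul_le _ _
      _ ≤ ‖p‖ * ‖1 - q‖ * ‖p‖ := by gcongr; exact norm_mul_le _ _
      _ ≤ 1 * 1 * 1 := by gcongr
      _ = 1 := by norm_num
  have hpow (n : ℕ) : (1 - p * q * p) ^ (n + 1) = (1 - p) + y ^ (n + 1) := by
    induction n with
    | zero => simpa using hx
    | succ n ih =>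
      rw [pow_succ, ih, hx, add_mul, mul_add, mul_add, hpy, pow_succ y n, mul_assoc, hyp,
        hp.one_sub.isIdempotentElem.eq]
      simp [pow_succ, mul_assoc]
  refine hsa.norm_le_one_of_pow_norm_le (K := 1 + 1) fun n ↦ ?_
  rw [hpow]
  refine (norm_add_le _ _).trans (add_le_add (IsStarProjection.norm_le _ hp.one_sub) ?_)
  exact (norm_pow_le' y n.succ_pos).trans (pow_le_one₀ (norm_nonneg y) hy1)

variable [NormedAlgebra ℂ A] [CompleteSpace A]

/-- The star operation is not assumed to be conjugate-linear. -/
theorem IsSelfAdjoint.eq_zero_of_spectrum_subset {x : A} (hx : IsSelfAdjoint x)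
    (h : ∀ z ∈ spectrum ℂ x, z = 0) : x = 0 := by
  nontriviality A
  have hr : spectralRadius ℂ x = 0 := by
    simp only [spectralRadius, ENNReal.iSup_eq_zero]
    exact fun z hz ↦ by simp [h z hz]
  have hlim := (spectrum.pow_nnnorm_pow_one_div_tendsto_nhds_spectralRadius x).comp
    (tendsto_pow_atTop_atTop_of_one_lt one_lt_two)
  have hconst : ((fun n : ℕ ↦ (‖x ^ n‖₊ : ENNReal) ^ (1 / n : ℝ)) ∘ fun n : ℕ ↦ 2 ^ n) =
      fun _ ↦ (‖x‖₊ : ENNReal) := by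
    funext n
    rw [Function.comp_apply, hx.nnnorm_pow_two_pow, ENNReal.coe_pow, ← ENNReal.rpow_natCast,
      ← ENNReal.rpow_mul]
    simp
  rw [hconst, hr] at hlim
  simpa using tendsto_nhds_unique tendsto_const_nhds hlim

theorem IsSelfAdjoint.eq_zero_of_norm_one_sub_le_of_norm_natCast_add_le {x : A}
    (hx : IsSelfAdjoint x) (h₁ : ‖1 - x‖ ≤ 1) (m : ℕ) (h₂ : ‖(m : A) + x‖ ≤ m) : x = 0 := by
  nontriviality A
  refine hx.eq_zero_of_spectrum_subset fun z hz ↦ ?_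
  have hz₁ : ‖1 - z‖ ≤ 1 := by
    refine (spectrum.norm_le_norm_of_mem (a := 1 - x) ?_).trans h₁
    have := spectrum.singleton_sub_eq x (1 : ℂ)
    rw [map_one] at this
    rw [← this]
    exact Set.sub_mem_sub rfl hz
  have hz₂ : ‖(m : ℂ) + z‖ ≤ m := by
    refine (spectrum.norm_le_norm_of_mem (a := (m : A) + x) ?_).trans h₂
    have := spectrum.singleton_add_eq x (m : ℂ)
    rw [map_natCast] at this
    rw [← this]
    exact Set.add_mem_add rfl hz
  have hm : (0 : ℝ) ≤ m := m.cast_nonneg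
  have e₁ : (1 - z.re) ^ 2 + z.im ^ 2 ≤ 1 := by
    have := pow_le_pow_left₀ (norm_nonneg _) hz₁ 2
    rw [Complex.sq_norm, Complex.normSq_apply] at this
    simp at this
    nlinarith
  have e₂ : (m + z.re) ^ 2 + z.im ^ 2 ≤ (m : ℝ) ^ 2 := by
    have := pow_le_pow_left₀ (norm_nonneg _) hz₂ 2
    rw [Complex.sq_norm, Complex.normSq_apply] at this
    simp at this
    nlinarith
  have hre : 0 ≤ z.re := by nlinarith [sq_nonneg z.re, sq_nonneg z.im]
  have hmre : 0 ≤ m * z.re := mul_nonneg hm hre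
  have hre₀ : z.re = 0 := by nlinarith [sq_nonneg z.re, sq_nonneg z.im]
  have him₀ : z.im = 0 := by nlinarith [sq_nonneg z.re, sq_nonneg z.im]
  exact Complex.ext hre₀ him₀

/-- Projections summing to `1` are pairwise orthogonal. -/
theorem IsStarProjection.mul_eq_zero_of_sum_eq_one {ι : Type*} [Fintype ι] {p : ι → A}
    (hp : ∀ i, IsStarProjection (p i)) (hsum : ∑ i, p i = 1) {i j : ι} (hij : i ≠ j) :
    p i * p j = 0 := by
  classical
  have hpj : p j * p j = p j := (hp j).isIdempotentElem.eq
  have hi : i ∈ Finset.univ.erase j := by simp [hij]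
  set s := (Finset.univ.erase j).erase i
  have hzero : p j * p i * p j + ∑ k ∈ s, p j * p k * p j = 0 := by
    rw [Finset.add_sum_erase _ (fun k ↦ p j * p k * p j) hi]
    have h := Finset.add_sum_erase _ (fun k ↦ p j * p k * p j) (Finset.mem_univ j)
    rw [← Finset.sum_mul Finset.univ, ← Finset.mul_sum Finset.univ, hsum] at h
    rw [mul_one, hpj, hpj] at h
    exact add_eq_left.mp h
  have hsa : IsSelfAdjoint (p j * p i * p j) := by
    simp [IsSelfAdjoint, (hp _).isSelfAdjoint.star_eq, mul_assoc]
  have hcard : ((s.card : ℕ) : A) + p j * p i * p j = ∑ k ∈ s, (1 - p j * p k * p j) := by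
    rw [eq_neg_of_add_eq_zero_left hzero]
    simp [Finset.sum_sub_distrib, sub_eq_add_neg (s.card : A)]
  have h := hsa.eq_zero_of_norm_one_sub_le_of_norm_natCast_add_le
    ((hp j).norm_one_sub_mul_mul_le (hp i)) s.card (by
      rw [hcard]
      simpa using norm_sum_le_of_le s fun k _ ↦ (hp j).norm_one_sub_mul_mul_le (hp k))
  rw [← CStarRing.star_mul_self_eq_zero_iff, star_mul, (hp i).isSelfAdjoint.star_eq,
    (hp j).isSelfAdjoint.star_eq, mul_assoc, ← mul_assoc (p i), (hp i).isIdempotentElem.eq,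
    ← mul_assoc, h]

end SelfAdjoint

namespace IsMagicUnitary

variable {I J A : Type*} [Fintype I] [Fintype J] [NormedRing A] [StarRing A] {u : I → J → A}

theorem isStarProjection (hu : IsMagicUnitary u) (i : I) (j : J) : IsStarProjection (u i j) :=
  ⟨hu.2.1 i j, hu.1 i j⟩

variable [CStarRing A] [NormedAlgebra ℂ A] [CompleteSpace A]

theorem mul_eq_zero_of_row (hu : IsMagicUnitary u) (i : I) {j l : J} (h : j ≠ l) :
    u i j * u i l = 0 :=
  IsStarProjection.mul_eq_zero_of_sum_eq_one (hu.isStarProjection i) (hu.2.2.1 i) h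

theorem mul_eq_zero_of_col (hu : IsMagicUnitary u) (j : J) {i k : I} (h : i ≠ k) :
    u i j * u k j = 0 :=
  IsStarProjection.mul_eq_zero_of_sum_eq_one (p := fun i ↦ u i j)
    (fun i ↦ hu.isStarProjection i j) (hu.2.2.2 j) h

/-- Multiplying on the left by `u i j` the sum of the entries of row `i` over a set of columns. -/
theorem mul_sum_row (hu : IsMagicUnitary u) (i : I) (j : J) (P : J → Prop) [DecidablePred P] :
    u i j * ∑ l, u i l * (if P l then 1 else 0) = if P j then u i j else 0 := by
  rw [Finset.mul_sum, Finset.sum_eq_single j]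
  · simp [hu.2.1 i j]
  · intro l _ hl
    rw [← mul_assoc, hu.mul_eq_zero_of_row i hl.symm, zero_mul]
  · simp

/-- Multiplying on the right by `u k l` the sum of the entries of column `l` over a set of rows. -/
theorem sum_col_mul (hu : IsMagicUnitary u) (k : I) (l : J) (P : I → Prop) [DecidablePred P] :
    (∑ i, (if P i then 1 else 0) * u i l) * u k l = if P k then u k l else 0 := by
  rw [Finset.sum_mul, Finset.sum_eq_single k]
  · simp [hu.2.1 k l]
  · intro i _ hi
    rw [mul_assoc, hu.mul_eq_zero_of_col l hi, mul_zero]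
  · simp

end IsMagicUnitary

/-- Lemma 2.8: for a finite edge-colored graph (edge color classes `E c`, pairwise
disjoint, symmetric and irreflexive) and a magic unitary `u` over a unital C*-algebra,
`u` commutes with every color adjacency matrix `A_{G_c}` if and only if
`u_{ij} u_{kl} = 0` whenever exactly one of `(i,k)` and `(j,l)` is an edge of some
color `c`. -/
theorem magicUnitaryCommutesIffProductRelations
    {V C A : Type*} [Fintype V]
    [NormedRing A] [StarRing A] [CStarRing A] [NormedAlgebra ℂ A] [CompleteSpace A]
    (E : C → V → V → Prop) [∀ c, DecidableRel (E c)]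
    (hsymm : ∀ c v w, E c v w → E c w v)
    (hirr : ∀ c v, ¬ E c v v)
    (hdisj : ∀ c c' v w, E c v w → E c' v w → c = c')
    (u : V → V → A) (hmu : IsMagicUnitary u) :
    (∀ (c : C) (i l : V),
        (∑ k, (if E c i k then (1 : A) else 0) * u k l)
          = ∑ j, u i j * (if E c j l then (1 : A) else 0)) ↔
    (∀ (c : C) (i j k l : V),
        (E c i k ∧ ¬ E c j l → u i j * u k l = 0) ∧
        (¬ E c i k ∧ E c j l → u i j * u k l = 0)) := by
  constructor
  · intro h c i j k l
    have key : u i j * (if E c i k then u k l else 0) =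
        (if E c j l then u i j else 0) * u k l := by
      rw [← hmu.sum_col_mul k l (E c i), ← hmu.mul_sum_row i j (fun j ↦ E c j l), h c i l,
        mul_assoc]
    constructor <;> rintro ⟨h₁, h₂⟩
    · simpa [h₁, h₂] using key
    · simpa [h₁, h₂] using key.symm
  · intro h c i l
    have key (j k : V) : u i j * ((if E c i k then 1 else 0) * u k l) =
        u i j * (if E c j l then 1 else 0) * u k l := by
      have h' := h c i j k l
      by_cases h₁ : E c i k <;> by_cases h₂ : E c j l <;> simp [h₁, h₂] at h' ⊢ <;> simp [h']
    calc ∑ k, (if E c i k then (1 : A) else 0) * u k l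
        = (∑ j, u i j) * ∑ k, (if E c i k then (1 : A) else 0) * u k l := by
          rw [hmu.2.2.1 i, one_mul]
      _ = (∑ j, u i j * (if E c j l then (1 : A) else 0)) * ∑ k, u k l := by
          simp_rw [Finset.sum_mul_sum, key]
      _ = ∑ j, u i j * (if E c j l then (1 : A) else 0) := by
          rw [hmu.2.2.2 l, mul_one]
end

section
/- Let M ∈ F_2^{m×n} and let x_1,…,x_n be elements of a unital C*-algebra A satisfying the homogeneous solution group relations for M. For k ∈ [m] and α ∈ ±1^{S_k}, define v^{(k)}_α = ∏_{i∈S_k} (1 + α_i x_i)/2 (product in increasing order of indices; the factors commute). Then: each v^{(k)}_α is a projection; v^{(k)}_α v^{(k)}_β = 0 whenever α ≠ β; v^{(k)}_α = 0 whenever ∏_{i∈S_k} α_i = −1; and Σ_{α ∈ ±1^{S_k}_0} v^{(k)}_α = 1. -/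
open scoped BigOperators

/-- The sign `(-1)^x` for `x ∈ F₂`. -/
def signZ (x : ZMod 2) : ℤˣ := if x = 0 then 1 else -1

/-- `S_k = {i : M k i = 1}`. -/
def Sk {m n : ℕ} (M : Matrix (Fin m) (Fin n) (ZMod 2)) (k : Fin m) : Finset (Fin n) :=
  Finset.univ.filter fun i => M k i = 1

/-- The vertex set of the colored graph `G(M,b)`: pairs `(k, α)` where
`α : ±1^{S_k}` with `∏_{i ∈ S_k} α i = (-1)^{b k}`, encoded as functions on `Fin n`
normalized to `1` off `S_k`. -/
abbrev GVertex {m n : ℕ} (M : Matrix (Fin m) (Fin n) (ZMod 2)) (b : Fin m → ZMod 2) : Type :=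
  {p : Fin m × (Fin n → ℤˣ) //
    (∀ i, i ∉ Sk M p.1 → p.2 i = 1) ∧ ∏ i ∈ Sk M p.1, p.2 i = signZ (b p.1)}

/-- `v` and `w` are joined by an edge of color `({l,k}, δ|_{S_l ∩ S_k})` in `G(M,b)`. -/
def adjC {m n : ℕ} (M : Matrix (Fin m) (Fin n) (ZMod 2)) (b : Fin m → ZMod 2)
    (l k : Fin m) (δ : Fin n → ℤˣ) (v w : GVertex M b) : Prop :=
  ((v.1.1 = l ∧ w.1.1 = k) ∨ (v.1.1 = k ∧ w.1.1 = l)) ∧ v ≠ w ∧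
    (Sk M l ∩ Sk M k).Nonempty ∧
    ∀ i ∈ Sk M l ∩ Sk M k, v.1.2 i * w.1.2 i = δ i

open Classical in
/-- The 0/1 adjacency matrix (with entries in `A`) of the color class
`({l,k}, δ|_{S_l ∩ S_k})` of the colored graph `G(M,b)`. -/
noncomputable def adjMat (A : Type*) [Zero A] [One A] {m n : ℕ}
    (M : Matrix (Fin m) (Fin n) (ZMod 2)) (b : Fin m → ZMod 2)
    (l k : Fin m) (δ : Fin n → ℤˣ) (v w : GVertex M b) : A :=
  if adjC M b l k δ v w then 1 else 0

/-- `u` satisfies the `Qut(G(M,b))` relations: entries vanish between distinct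
vertex colors, and `u` commutes with every edge-color adjacency matrix. -/
def QutRel (A : Type*) [Ring A] {m n : ℕ} (M : Matrix (Fin m) (Fin n) (ZMod 2))
    (b : Fin m → ZMod 2) (u : GVertex M b → GVertex M b → A) : Prop :=
  (∀ v w : GVertex M b, v.1.1 ≠ w.1.1 → u v w = 0) ∧
  ∀ (l k : Fin m) (δ : Fin n → ℤˣ) (v w : GVertex M b),
    ∑ x, adjMat A M b l k δ v x * u x w = ∑ x, u v x * adjMat A M b l k δ x w

/-- `x : Fin n → A` satisfies the homogeneous solution group relations for `M`:
each `x i` is a self-adjoint involution, `x i` and `x j` commute whenever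
`i, j ∈ S_k` for some `k`, and `∏_{i ∈ S_k} x i = 1` (in increasing order) for all `k`. -/
def SolRel {m n : ℕ} {A : Type*} [Ring A] [StarRing A]
    (M : Matrix (Fin m) (Fin n) (ZMod 2)) (x : Fin n → A) : Prop :=
  (∀ i, star (x i) = x i) ∧ (∀ i, x i * x i = 1) ∧
    (∀ (k : Fin m) (i j : Fin n), i ∈ Sk M k → j ∈ Sk M k → x i * x j = x j * x i) ∧
    (∀ k : Fin m, (((Sk M k).sort (· ≤ ·)).map x).prod = 1)

/-- `v^{(k)}_α = ∏_{i ∈ S_k} (1 + α_i x_i)/2`, product in increasing order of indices. -/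
noncomputable def vproj {m n : ℕ} {A : Type*} [Ring A] [Algebra ℂ A]
    (M : Matrix (Fin m) (Fin n) (ZMod 2)) (x : Fin n → A)
    (k : Fin m) (α : Fin n → ℤˣ) : A :=
  (((Sk M k).sort (· ≤ ·)).map (fun i => ((2 : ℂ)⁻¹) • (1 + ((α i : ℤ) • x i)))).prod

/-- `(1 + a y) / 2`, the spectral projection of an involution `y` at the sign `a`. -/
noncomputable def signProj {B : Type*} [Ring B] [Algebra ℂ B] (y : B) (a : ℤˣ) : B :=
  (2 : ℂ)⁻¹ • (1 + (a : ℤ) • y)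

section SignProj

variable {B : Type*} [Ring B] [Algebra ℂ B]

theorem eq_zero_of_eq_neg_of_complex {b : B} (h : b = -b) : b = 0 := by
  have h2 : (2 : ℂ) • b = 0 := by
    rw [two_smul]
    nth_rewrite 2 [h]
    exact add_neg_cancel b
  simpa using congrArg (fun z => (2 : ℂ)⁻¹ • z) h2

theorem signProj_mul_self {y : B} (hy : y * y = 1) (a : ℤˣ) :
    signProj y a * signProj y a = signProj y a := by
  have h : (1 + (a : ℤ) • y) * (1 + (a : ℤ) • y) = (2 : ℂ) • (1 + (a : ℤ) • y) := by
    rcases Int.units_eq_one_or a with rfl | rfl <;>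
      simp only [Units.val_one, Units.val_neg, one_smul, neg_smul, mul_add, add_mul, hy,
        mul_one, one_mul, neg_mul, mul_neg, two_smul] <;> abel
  rw [signProj, smul_mul_smul_comm, h, smul_smul]
  norm_num

theorem signProj_mul_of_ne {y : B} (hy : y * y = 1) {a b : ℤˣ} (hab : a ≠ b) :
    signProj y a * signProj y b = 0 := by
  have h : (1 + (a : ℤ) • y) * (1 + (b : ℤ) • y) = 0 := by
    rcases Int.units_eq_one_or a with rfl | rfl <;>
      rcases Int.units_eq_one_or b with rfl | rfl
    · exact absurd rfl hab
    · simp only [Units.val_one, Units.val_neg, one_smul, neg_smul, mul_add, add_mul, hy,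
        mul_one, one_mul, mul_neg]
      abel
    · simp [mul_add, add_mul, hy]
    · exact absurd rfl hab
  rw [signProj, signProj, smul_mul_smul_comm, h, smul_zero]

theorem smul_mul_signProj {y : B} (hy : y * y = 1) (a : ℤˣ) :
    ((a : ℤ) • y) * signProj y a = signProj y a := by
  rw [signProj, mul_smul_comm]
  rcases Int.units_eq_one_or a with rfl | rfl <;> simp [mul_add, hy, add_comm]

theorem sum_signProj (y : B) : ∑ a : ℤˣ, signProj y a = 1 := by
  have h : (Finset.univ : Finset ℤˣ) = {1, -1} := rfl
  rw [h, Finset.sum_pair (by decide), signProj, signProj, ← smul_add]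
  have h2 : (1 + ((1 : ℤˣ) : ℤ) • y) + (1 + ((-1 : ℤˣ) : ℤ) • y) = (2 : ℂ) • (1 : B) := by
    simp only [Units.val_one, Units.val_neg, one_smul, neg_smul, two_smul]
    abel
  rw [h2, smul_smul]
  norm_num

theorem star_signProj [StarRing B] {y : B} (hy : star y = y) (a : ℤˣ) :
    star (signProj y a) = signProj y a := by
  have h : (2 : ℂ) • signProj y a = 1 + (a : ℤ) • y := by simp [signProj, smul_smul]
  have hs : (2 : ℂ) • star (signProj y a) = (2 : ℂ) • signProj y a := by
    have := congrArg star h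
    rw [two_smul, star_add] at this
    rw [two_smul, this, h]
    rcases Int.units_eq_one_or a with rfl | rfl <;> simp [hy]
  simpa [smul_smul] using congrArg (fun z => (2 : ℂ)⁻¹ • z) hs

theorem commute_signProj {y z : B} (h : Commute y z) (a b : ℤˣ) :
    Commute (signProj y a) (signProj z b) :=
  ((((Commute.one_left _).add_left (Commute.smul_left ((Commute.one_right _).add_right
    (h.smul_right _)) _)).smul_left _).smul_right _)

end SignProj

section Commutative

variable {ι B : Type*} [CommRing B] [Algebra ℂ B]

theorem prod_signProj_mul_self (s : Finset ι) {y : ι → B} (hy : ∀ i, y i * y i = 1)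
    (α : ι → ℤˣ) :
    (∏ i ∈ s, signProj (y i) (α i)) * ∏ i ∈ s, signProj (y i) (α i) =
      ∏ i ∈ s, signProj (y i) (α i) := by
  rw [← Finset.prod_mul_distrib]
  exact Finset.prod_congr rfl fun i _ => signProj_mul_self (hy i) _

theorem prod_signProj_mul_of_ne {s : Finset ι} {y : ι → B} (hy : ∀ i, y i * y i = 1)
    {α β : ι → ℤˣ} (h : ∃ i ∈ s, α i ≠ β i) :
    (∏ i ∈ s, signProj (y i) (α i)) * ∏ i ∈ s, signProj (y i) (β i) = 0 := by
  obtain ⟨i, hi, hne⟩ := h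
  rw [← Finset.prod_mul_distrib]
  exact Finset.prod_eq_zero hi (signProj_mul_of_ne (hy i) hne)

theorem prod_signProj_eq_zero {s : Finset ι} {y : ι → B} (hy : ∀ i, y i * y i = 1)
    (hprod : ∏ i ∈ s, y i = 1) {α : ι → ℤˣ} (hα : ∏ i ∈ s, α i = -1) :
    ∏ i ∈ s, signProj (y i) (α i) = 0 := by
  apply eq_zero_of_eq_neg_of_complex
  have hsign : ∏ i ∈ s, ((α i : ℤ) • y i) = -1 := by
    simp only [zsmul_eq_mul, Finset.prod_mul_distrib, hprod, mul_one]
    rw [← Int.cast_prod, ← Units.coe_prod, hα]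
    simp
  calc ∏ i ∈ s, signProj (y i) (α i)
      = ∏ i ∈ s, ((α i : ℤ) • y i) * signProj (y i) (α i) :=
        Finset.prod_congr rfl fun i _ => (smul_mul_signProj (hy i) _).symm
    _ = -∏ i ∈ s, signProj (y i) (α i) := by
        rw [Finset.prod_mul_distrib, hsign, neg_one_mul]

theorem sum_prod_signProj [Fintype ι] [DecidableEq ι] (s : Finset ι) (y : ι → B) :
    ∑ α ∈ Finset.univ.filter (fun α : ι → ℤˣ => ∀ i, i ∉ s → α i = 1),
      ∏ i ∈ s, signProj (y i) (α i) = 1 := by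
  have h := Finset.prod_univ_sum (fun i => if i ∈ s then (Finset.univ : Finset ℤˣ) else {1})
    (fun i a => if i ∈ s then signProj (y i) a else 1)
  have hl : ∏ i, ∑ a ∈ (if i ∈ s then (Finset.univ : Finset ℤˣ) else {1}),
      (if i ∈ s then signProj (y i) a else 1) = 1 := by
    refine Finset.prod_eq_one fun i _ => ?_
    by_cases hi : i ∈ s
    · simpa only [if_pos hi] using sum_signProj (y i)
    · simp [hi]
  rw [hl] at h
  rw [h]
  refine Finset.sum_congr ?_ fun α _ => ?_
  · ext α
    simp only [Finset.mem_filter, Finset.mem_univ, true_and, Fintype.mem_piFinset]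
    refine forall_congr' fun i => ?_
    by_cases hi : i ∈ s
    · simp only [hi, not_true_eq_false, false_imp_iff, if_true, Finset.mem_univ]
    · simp [hi]
  · simp [Finset.prod_ite_mem]

theorem sum_prod_signProj_of_prod_eq_one [Fintype ι] [DecidableEq ι] {s : Finset ι} {y : ι → B}
    (hy : ∀ i, y i * y i = 1) (hprod : ∏ i ∈ s, y i = 1) :
    ∑ α ∈ Finset.univ.filter (fun α : ι → ℤˣ => (∀ i, i ∉ s → α i = 1) ∧ ∏ i ∈ s, α i = 1),
      ∏ i ∈ s, signProj (y i) (α i) = 1 := by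
  rw [← sum_prod_signProj s y, ← Finset.filter_filter, Finset.sum_filter_of_ne]
  intro α _ hne
  exact (Int.units_eq_one_or _).resolve_right fun h => hne (prod_signProj_eq_zero hy hprod h)

end Commutative

open scoped IsMulCommutative in
/-- The elements `x i`, `i ∈ S_k`, are images of commuting involutions with product `1`
in a commutative algebra. -/
theorem SolRel.exists_commutative_lift.{u} {m n : ℕ} {A : Type u} [Ring A] [StarRing A] [Algebra ℂ A]
    {M : Matrix (Fin m) (Fin n) (ZMod 2)} {x : Fin n → A} (hx : SolRel M x) (k : Fin m) :
    ∃ (B : Type u) (_ : CommRing B) (_ : Algebra ℂ B) (φ : B →ₐ[ℂ] A) (y : Fin n → B),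
      (∀ i, y i * y i = 1) ∧ ∏ i ∈ Sk M k, y i = 1 ∧
        ∀ α, vproj M x k α = φ (∏ i ∈ Sk M k, signProj (y i) (α i)) := by
  obtain ⟨-, hsq, hcomm, hprod⟩ := hx
  have hc : ∀ a ∈ Set.image x (Sk M k), ∀ b ∈ Set.image x (Sk M k),
      a * b = b * a := by
    rintro _ ⟨i, hi, rfl⟩ _ ⟨j, hj, rfl⟩
    exact hcomm k i j hi hj
  let S := Algebra.adjoin ℂ (Set.image x (Sk M k))
  have : IsMulCommutative S := Algebra.isMulCommutative_adjoin ℂ hc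
  let y : Fin n → S := fun i =>
    if hi : i ∈ Sk M k then ⟨x i, Algebra.subset_adjoin ⟨i, hi, rfl⟩⟩ else 1
  have hy : ∀ i ∈ Sk M k, S.val (y i) = x i := fun i hi => by simp [y, hi]
  have hlist (f : Fin n → S) : ∏ i ∈ Sk M k, f i = (((Sk M k).sort (· ≤ ·)).map f).prod := by
    rw [← List.prod_toFinset _ (Finset.sort_nodup _ _), Finset.sort_toFinset]
  refine ⟨S, inferInstance, inferInstance, S.val, y, fun i => ?_, ?_, fun α => ?_⟩
  · by_cases hi : i ∈ Sk M k
    · apply Subtype.val_injective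
      have := hsq i
      rw [← hy i hi] at this
      exact this
    · simp [y, hi]
  · apply Subtype.val_injective
    change S.val _ = 1
    rw [hlist, map_list_prod, List.map_map, ← hprod k]
    exact congrArg List.prod (List.map_congr_left fun i hi => hy i (by simpa using hi))
  · rw [hlist, map_list_prod, List.map_map, vproj]
    refine congrArg List.prod (List.map_congr_left fun i hi => ?_)
    have := hy i (by simpa using hi)
    simp only [Function.comp, signProj, map_smul, map_add, map_one, map_zsmul, this]

theorem star_list_prod_of_commute {R : Type*} [Monoid R] [StarMul R] {l : List R}
    (hstar : ∀ a ∈ l, star a = a) (hcomm : l.Pairwise Commute) : star l.prod = l.prod := by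
  induction l with
  | nil => simp
  | cons a l ih =>
    rw [List.pairwise_cons] at hcomm
    rw [List.prod_cons, star_mul, hstar a (by simp),
      ih (fun b hb => hstar b (List.mem_cons_of_mem _ hb)) hcomm.2]
    exact (Commute.list_prod_right _ _ hcomm.1).symm

theorem SolRel.star_vproj {m n : ℕ} {A : Type*} [Ring A] [StarRing A] [Algebra ℂ A]
    {M : Matrix (Fin m) (Fin n) (ZMod 2)} {x : Fin n → A} (hx : SolRel M x) (k : Fin m)
    (α : Fin n → ℤˣ) : star (vproj M x k α) = vproj M x k α := by
  obtain ⟨hstar, -, hcomm, -⟩ := hx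
  change star (((Sk M k).sort (· ≤ ·)).map fun i => signProj (x i) (α i)).prod =
    (((Sk M k).sort (· ≤ ·)).map fun i => signProj (x i) (α i)).prod
  refine star_list_prod_of_commute ?_ ?_
  · simp only [List.forall_mem_map]
    exact fun i _ => star_signProj (hstar i) _
  · rw [List.pairwise_map]
    refine List.pairwise_of_forall_mem_list fun i hi j hj => ?_
    exact commute_signProj (hcomm k _ _ (by simpa using hi) (by simpa using hj)) _ _

/-- The elements `v^{(k)}_α` built from a representation of the homogeneous solution group
are projections, pairwise orthogonal for distinct `α ∈ ±1^{S_k}`, vanish when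
`∏_{i ∈ S_k} α_i = -1`, and sum to `1` over `α ∈ ±1^{S_k}_0`. -/
theorem vprojProperties {m n : ℕ} (M : Matrix (Fin m) (Fin n) (ZMod 2))
    {A : Type*} [NormedRing A] [StarRing A] [CStarRing A] [NormedAlgebra ℂ A]
    [CompleteSpace A]
    (x : Fin n → A) (hx : SolRel M x) (k : Fin m) :
    (∀ α : Fin n → ℤˣ, star (vproj M x k α) = vproj M x k α ∧
      vproj M x k α * vproj M x k α = vproj M x k α) ∧
    (∀ α β : Fin n → ℤˣ, (∃ i ∈ Sk M k, α i ≠ β i) →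
      vproj M x k α * vproj M x k β = 0) ∧
    (∀ α : Fin n → ℤˣ, (∏ i ∈ Sk M k, α i) = -1 → vproj M x k α = 0) ∧
    (∑ α ∈ Finset.univ.filter (fun α : Fin n → ℤˣ =>
        (∀ i, i ∉ Sk M k → α i = 1) ∧ (∏ i ∈ Sk M k, α i) = 1),
      vproj M x k α) = 1 := by
  obtain ⟨B, _, _, φ, y, hy, hprod, hv⟩ := hx.exists_commutative_lift k
  refine ⟨fun α => ⟨hx.star_vproj k α, ?_⟩, fun α β h => ?_, fun α h => ?_, ?_⟩
  · rw [hv, ← map_mul, prod_signProj_mul_self _ hy]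
  · rw [hv, hv, ← map_mul, prod_signProj_mul_of_ne hy h, map_zero]
  · rw [hv, prod_signProj_eq_zero hy hprod h, map_zero]
  · simp only [hv]
    rw [← map_sum, ← map_one φ, ← sum_prod_signProj_of_prod_eq_one hy hprod]
    congr!
end

section
/- Let G be a finite simple graph with adjacency matrix A_G, and let u be a magic unitary over a unital C*-algebra indexed by V(G) with A_G u = u A_G. If v,w,p,q ∈ V(G) satisfy d(v,p) ≠ d(w,q), where d denotes the graph distance (valued in ℕ ∪ {∞}), then u_{vw} u_{pq} = 0. -/
open scoped BigOperators

theorem mem_spectrum_of_mem_corner {𝕜 A : Type*} [Field 𝕜] [Ring A] [Algebra 𝕜 A]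
    {p y : A} (hp : p * p = p) (hpy : p * y = y) (hyp : y * p = y) (α : 𝕜) {μ : 𝕜}
    (hμ : μ ≠ 0) (hmem : μ ∈ spectrum 𝕜 y) : α + μ ∈ spectrum 𝕜 (α • p + y) := by
  rw [spectrum.mem_iff] at hmem ⊢
  contrapose! hmem
  obtain ⟨⟨x, z, hxz, hzx⟩, rfl : x = _⟩ := hmem
  set x := algebraMap 𝕜 A (α + μ) - (α • p + y) with hx
  have hleft : (algebraMap 𝕜 A μ - y) * p = p * x := by
    simp only [hx, Algebra.algebraMap_eq_smul_one, sub_mul, mul_sub, mul_add, smul_mul_assoc,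
      mul_smul_comm, one_mul, mul_one, hp, hpy, hyp, add_smul]
    abel
  have hright : p * (algebraMap 𝕜 A μ - y) = x * p := by
    simp only [hx, Algebra.algebraMap_eq_smul_one, sub_mul, mul_sub, add_mul, smul_mul_assoc,
      mul_smul_comm, one_mul, mul_one, hp, hpy, hyp, add_smul]
    abel
  have hl : (algebraMap 𝕜 A μ - y) * (1 - p) = μ • (1 - p) := by
    simp only [Algebra.algebraMap_eq_smul_one, sub_mul, mul_sub, smul_mul_assoc, one_mul, mul_one,
      hyp, smul_sub]
    abel
  have hr : (1 - p) * (algebraMap 𝕜 A μ - y) = μ • (1 - p) := by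
    simp only [Algebra.algebraMap_eq_smul_one, sub_mul, mul_sub, mul_smul_comm, one_mul, mul_one,
      hpy, sub_self, sub_zero, smul_sub]
  refine ⟨⟨_, μ⁻¹ • (1 - p) + p * z * p, ?_, ?_⟩, rfl⟩
  · rw [mul_add, mul_smul_comm, hl, smul_smul, inv_mul_cancel₀ hμ, one_smul, ← mul_assoc,
      ← mul_assoc, hleft, mul_assoc p x z, hxz, mul_one, hp, sub_add_cancel]
  · rw [add_mul, smul_mul_assoc, hr, smul_smul, inv_mul_cancel₀ hμ, one_smul, mul_assoc,
      hright, mul_assoc p z, ← mul_assoc z, hzx, one_mul, hp, sub_add_cancel]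

section CStarRing

variable {A : Type*} [NormedRing A] [StarRing A] [CStarRing A]

theorem norm_le_one_of_star_mul_self_eq_self {p : A} (hs : star p = p) (hp : p * p = p) :
    ‖p‖ ≤ 1 := by
  have h := CStarRing.norm_star_mul_self (x := p)
  rw [hs, hp] at h
  nlinarith [norm_nonneg p]

theorem norm_sub_two_mul_compress_le_one {p e : A} (hps : star p = p) (hp : p * p = p)
    (hes : star e = e) (he : e * e = e) : ‖p - 2 * (p * e * p)‖ ≤ 1 := by
  have hsymm : ‖(1 : A) - 2 * e‖ ≤ 1 ∨ Subsingleton A := by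
    rcases subsingleton_or_nontrivial A with h | h
    · exact Or.inr h
    · have h1 := CStarRing.norm_star_mul_self (x := (1 : A) - 2 * e)
      have h2 : star ((1 : A) - 2 * e) * (1 - 2 * e) = 1 := by
        simp only [two_mul, star_sub, star_one, star_add, hes, sub_mul, mul_sub, add_mul,
          mul_add, one_mul, mul_one, he]
        abel
      rw [h2, CStarRing.norm_one] at h1
      left
      nlinarith [norm_nonneg ((1 : A) - 2 * e)]
  rcases hsymm with h | h
  · have hn := norm_le_one_of_star_mul_self_eq_self hps hp
    have heq : p - 2 * (p * e * p) = p * (1 - 2 * e) * p := by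
      simp only [two_mul, mul_sub, sub_mul, mul_add, add_mul, mul_one, hp]
    rw [heq]
    calc ‖p * (1 - 2 * e) * p‖ ≤ ‖p‖ * ‖1 - 2 * e‖ * ‖p‖ := norm_mul₃_le
      _ ≤ 1 * 1 * 1 := by gcongr
      _ = 1 := by norm_num
  · rw [Subsingleton.elim (p - 2 * (p * e * p)) 0, norm_zero]
    exact zero_le_one

variable [NormedAlgebra ℂ A] [CompleteSpace A]

/-- Unlike `IsSelfAdjoint.spectralRadius_eq_nnnorm`, this needs no `StarModule ℂ A`. -/
theorem spectralRadius_eq_nnnorm_of_isSelfAdjoint {a : A} (ha : IsSelfAdjoint a) :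
    spectralRadius ℂ a = ‖a‖₊ := by
  refine tendsto_nhds_unique ?_
    (tendsto_const_nhds (x := (‖a‖₊ : ENNReal)) (f := (Filter.atTop : Filter ℕ)))
  convert! (spectrum.pow_nnnorm_pow_one_div_tendsto_nhds_spectralRadius a).comp
    (tendsto_pow_atTop_atTop_of_one_lt one_lt_two) using 1
  refine funext fun n => ?_
  rw [Function.comp_apply, ha.nnnorm_pow_two_pow, ENNReal.coe_pow, ← ENNReal.rpow_natCast,
    ← ENNReal.rpow_mul]
  simp

/-- The involution is not assumed to be conjugate-linear, so positivity of `star a * a` is not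
available; the proof locates the spectrum of a compression by norm estimates instead. -/
theorem mul_eq_zero_of_sum_projections_eq_one {ι : Type*} [Fintype ι] (e : ι → A)
    (hs : ∀ i, star (e i) = e i) (he : ∀ i, e i * e i = e i) (hsum : ∑ i, e i = 1)
    {i j : ι} (hij : i ≠ j) : e i * e j = 0 := by
  classical
  rcases subsingleton_or_nontrivial A with hA | hA
  · exact Subsingleton.elim _ _
  set p := e j with hp
  have hpp : p * p = p := he j
  let b : ι → A := fun k => p * e k * p
  have hbs : star (b i) = b i := by
    simp only [b, star_mul, hs, hp, mul_assoc]
  have hpb : p * b i = b i := by simp only [b, ← mul_assoc, hpp]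
  have hbp : b i * p = b i := by simp only [b, mul_assoc, hpp]
  have hbsum : ∑ k, b k = p := by
    simp only [b, ← Finset.mul_sum, ← Finset.sum_mul, hsum, mul_one, hpp]
  set T := (Finset.univ.erase j).erase i with hT
  have hTsum : ∑ k ∈ T, b k = - b i := by
    have h1 := Finset.add_sum_erase Finset.univ b (Finset.mem_univ j)
    have h2 := Finset.add_sum_erase (Finset.univ.erase j) b
      (Finset.mem_erase.2 ⟨hij, Finset.mem_univ i⟩)
    have h3 : b j = p := by simp only [b, ← hp, hpp]
    rw [hbsum, h3, ← h2] at h1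
    have h4 : b i + ∑ k ∈ T, b k = 0 := by simpa using h1
    exact (neg_eq_of_add_eq_zero_right h4).symm
  have hnorm : ∀ k, ‖p - 2 * b k‖ ≤ 1 := fun k =>
    norm_sub_two_mul_compress_le_one (hs j) hpp (hs k) (he k)
  have hnormT : ‖(T.card : ℂ) • p + (2 : ℂ) • b i‖ ≤ T.card := by
    have h1 : (T.card : ℂ) • p + (2 : ℂ) • b i = ∑ k ∈ T, (p - 2 * b k) := by
      rw [Finset.sum_sub_distrib, ← Finset.mul_sum, hTsum, Finset.sum_const, Nat.cast_smul_eq_nsmul,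
        two_smul, two_mul]
      abel
    rw [h1]
    simpa using norm_sum_le_of_le T fun k _ => hnorm k
  have hspec : ∀ μ ∈ spectrum ℂ (b i), μ = 0 := by
    intro μ hμ
    by_contra hμ0
    have h2μ : (2 : ℂ) * μ ∈ spectrum ℂ ((2 : ℂ) • b i) := by
      have := (spectrum.smul_mem_smul_iff (r := Units.mk0 (2 : ℂ) two_ne_zero)).2 hμ
      simpa [Units.smul_def] using this
    have hneg : -((2 : ℂ) * μ) ∈ spectrum ℂ (-((2 : ℂ) • b i)) := by
      rw [← spectrum.neg_eq]
      simpa using h2μ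
    have m1 := spectrum.norm_le_norm_of_mem (mem_spectrum_of_mem_corner hpp
      (by rw [mul_neg, mul_smul_comm, hpb]) (by rw [neg_mul, smul_mul_assoc, hbp]) 1
      (by simpa using hμ0) hneg)
    have m2 := (spectrum.norm_le_norm_of_mem (mem_spectrum_of_mem_corner hpp
      (by rw [mul_smul_comm, hpb]) (by rw [smul_mul_assoc, hbp]) (T.card : ℂ)
      (by simpa using hμ0) h2μ)).trans hnormT
    have hb : (1 : ℂ) • p + -((2 : ℂ) • b i) = p - 2 * b i := by
      rw [one_smul, two_smul, two_mul, sub_eq_add_neg]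
    rw [hb] at m1
    have m1 := m1.trans (hnorm i)
    have s1 := pow_le_pow_left₀ (norm_nonneg _) m1 2
    have s2 := pow_le_pow_left₀ (norm_nonneg _) m2 2
    rw [Complex.sq_norm, Complex.normSq_apply] at s1 s2
    simp at s1 s2
    have hc : (0 : ℝ) ≤ T.card := Nat.cast_nonneg _
    have hre : 0 ≤ μ.re := by nlinarith [sq_nonneg μ.re, sq_nonneg μ.im]
    have hcre := mul_nonneg hc hre
    apply hμ0
    apply Complex.ext
    · simp only [Complex.zero_re]
      nlinarith [sq_nonneg μ.re, sq_nonneg μ.im]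
    · simp only [Complex.zero_im]
      nlinarith [sq_nonneg μ.re, sq_nonneg μ.im]
  have hb0 : b i = 0 := by
    have h := spectralRadius_eq_nnnorm_of_isSelfAdjoint (a := b i) hbs
    have h0 : spectralRadius ℂ (b i) = 0 := by
      simp only [spectralRadius, ENNReal.iSup_eq_zero]
      intro μ hμ
      simp [hspec μ hμ]
    rw [h0] at h
    simpa using h.symm
  rw [← CStarRing.star_mul_self_eq_zero_iff]
  have : star (e i * p) * (e i * p) = b i := by
    rw [star_mul, hs i, hs j, mul_assoc, ← mul_assoc (e i), he i, ← mul_assoc]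
  rw [this, hb0]

end CStarRing

theorem mul_eq_zero_of_not_adj_iff {V A : Type*} [Fintype V] [Ring A]
    (G : SimpleGraph V) [DecidableRel G.Adj] (u : V → V → A)
    (hidem : ∀ i j, u i j * u i j = u i j)
    (hrow : ∀ v w q, w ≠ q → u v w * u v q = 0)
    (hcol : ∀ w v p, v ≠ p → u v w * u p w = 0)
    (hcomm : ∀ v w : V,
      (∑ x, (if G.Adj v x then (1 : A) else 0) * u x w)
        = ∑ x, u v x * (if G.Adj x w then (1 : A) else 0))
    {v w p q : V} (h : ¬(G.Adj v p ↔ G.Adj w q)) : u v w * u p q = 0 := by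
  have key := congrArg (fun a => u v w * a * u p q) (hcomm v q)
  simp only [Finset.mul_sum, Finset.sum_mul] at key
  rw [Finset.sum_eq_single p (fun x _ hx => by split_ifs <;> simp [mul_assoc, hcol q x p hx])
      (by simp),
    Finset.sum_eq_single w (fun x _ hx => by
      rw [← mul_assoc, hrow v w x hx.symm, zero_mul, zero_mul]) (by simp)] at key
  by_cases h1 : G.Adj v p <;> by_cases h2 : G.Adj w q
  · exact absurd (iff_of_true h1 h2) h
  · simpa [h1, h2, mul_assoc, hidem] using key
  · simpa [h1, h2, ← mul_assoc, hidem, eq_comm] using key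
  · exact absurd (iff_of_false h1 h2) h

theorem exists_walk_of_mul_ne_zero {V A : Type*} [Fintype V] [Ring A]
    (G : SimpleGraph V) (u : V → V → A) (hsum : ∀ i, ∑ j, u i j = 1)
    (hrow : ∀ v w q, w ≠ q → u v w * u v q = 0)
    (hadj : ∀ v w p q, G.Adj v p → ¬G.Adj w q → u v w * u p q = 0)
    {v p : V} (W : G.Walk v p) {w q : V} (h : u v w * u p q ≠ 0) :
    ∃ W' : G.Walk w q, W'.length = W.length := by
  induction W generalizing w with
  | nil =>
    obtain rfl : w = q := by
      by_contra hne
      exact h (hrow _ _ _ hne)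
    exact ⟨.nil, rfl⟩
  | @cons v v' p hvv W ih =>
    have hexp : u v w * u p q = ∑ x, u v w * u v' x * u p q := by
      rw [← Finset.sum_mul, ← Finset.mul_sum, hsum, mul_one]
    rw [hexp] at h
    obtain ⟨x, -, hx⟩ := Finset.exists_ne_zero_of_sum_ne_zero h
    have hwx : G.Adj w x := by
      by_contra hn
      exact hx (by rw [hadj v w v' x hvv hn, zero_mul])
    obtain ⟨W', hW'⟩ := ih (w := x) fun h0 => hx (by rw [mul_assoc, h0, mul_zero])
    exact ⟨.cons hwx W', by simp [hW']⟩

theorem edist_le_of_mul_ne_zero {V A : Type*} [Fintype V] [Ring A]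
    (G : SimpleGraph V) (u : V → V → A) (hsum : ∀ i, ∑ j, u i j = 1)
    (hrow : ∀ v w q, w ≠ q → u v w * u v q = 0)
    (hadj : ∀ v w p q, G.Adj v p → ¬G.Adj w q → u v w * u p q = 0)
    {v w p q : V} (h : u v w * u p q ≠ 0) : G.edist w q ≤ G.edist v p := by
  refine le_iInf fun W => ?_
  obtain ⟨W', hW'⟩ := exists_walk_of_mul_ne_zero G u hsum hrow hadj W h
  exact hW' ▸ W'.edist_le

/-- Lemma 4.2: if a magic unitary `u` over a unital C*-algebra commutes with the
adjacency matrix of a finite simple graph `G` and `d(v,p) ≠ d(w,q)` (graph distance,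
valued in `ℕ∞`), then `u_{vw} u_{pq} = 0`. -/
theorem distinctDistancesOrthogonal
    {V A : Type*} [Fintype V]
    [NormedRing A] [StarRing A] [CStarRing A] [NormedAlgebra ℂ A] [CompleteSpace A]
    (G : SimpleGraph V) [DecidableRel G.Adj]
    (u : V → V → A) (hmu : IsMagicUnitary u)
    (hcomm : ∀ v w : V,
      (∑ x, (if G.Adj v x then (1 : A) else 0) * u x w)
        = ∑ x, u v x * (if G.Adj x w then (1 : A) else 0))
    (v w p q : V) (h : G.edist v p ≠ G.edist w q) :
    u v w * u p q = 0 := by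
  obtain ⟨hs, hidem, hr, hc⟩ := hmu
  have hrow : ∀ v w q, w ≠ q → u v w * u v q = 0 := fun v w q hne =>
    mul_eq_zero_of_sum_projections_eq_one (u v) (hs v) (hidem v) (hr v) hne
  have hcol : ∀ w v p, v ≠ p → u v w * u p w = 0 := fun w v p hne =>
    mul_eq_zero_of_sum_projections_eq_one (fun i => u i w) (fun i => hs i w)
      (fun i => hidem i w) (hc w) hne
  have hadj : ∀ v w p q, ¬(G.Adj v p ↔ G.Adj w q) → u v w * u p q = 0 := fun _ _ _ _ =>
    mul_eq_zero_of_not_adj_iff G u hidem hrow hcol hcomm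
  by_contra hne
  refine h (le_antisymm ?_ ?_)
  · exact edist_le_of_mul_ne_zero G (fun i j => u j i) hc hcol
      (fun w v q p h1 h2 => hadj v w p q (by tauto)) hne
  · exact edist_le_of_mul_ne_zero G u hr hrow
      (fun v w p q h1 h2 => hadj v w p q (by tauto)) hne
end

section
/- Let G be a finite simple graph with adjacency matrix A_G, and let u be a magic unitary over a unital C*-algebra indexed by V(G) with A_G u = u A_G. Let v,w ∈ V(G) and k ∈ ℕ. If there exists p ∈ V(G) with d(v,p) = k such that deg(p) ≠ deg(q) for every q ∈ V(G) with d(w,q) = k, then u_{vw} = 0. (Here d denotes the graph distance and deg(x) the number of neighbors of x in G.) -/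
open scoped BigOperators

lemma star_I_commute {A : Type*} [Ring A] [StarRing A] [Algebra ℂ A] (x : A) :
    star (algebraMap ℂ A Complex.I) * x = x * star (algebraMap ℂ A Complex.I) := by
  have h := congrArg star (Algebra.commutes Complex.I (star x))
  simpa using h.symm

lemma star_I_mul_self {A : Type*} [Ring A] [StarRing A] [Algebra ℂ A] :
    star (algebraMap ℂ A Complex.I) * star (algebraMap ℂ A Complex.I) = -1 := by
  rw [← star_mul, ← map_mul, Complex.I_mul_I, map_neg, map_one, star_neg, star_one]

lemma star_I_smul {A : Type*} [Ring A] [StarRing A] [Algebra ℂ A] (x : A) :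
    star (Complex.I • x) = star (algebraMap ℂ A Complex.I) * star x := by
  rw [Algebra.smul_def, star_mul, star_I_commute]

/-- If `star I` acts on `x` as a scalar `± I`, then it acts on `star x` as the same scalar. -/
lemma star_I_mul_star {A : Type*} [Ring A] [StarRing A] [Algebra ℂ A] {ε : ℂ}
    (hε : ε * ε = -1) {x : A} (hx : star (algebraMap ℂ A Complex.I) * x = ε • x) :
    star (algebraMap ℂ A Complex.I) * star x = ε • star x := by
  have h1 : ε = Complex.I ∨ ε = -Complex.I := by
    rw [← mul_self_eq_mul_self_iff, hε, Complex.I_mul_I]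
  have h := congrArg star hx
  rw [star_mul, star_star, ← Algebra.commutes, ← Algebra.smul_def] at h
  rcases h1 with rfl | rfl
  · rw [star_I_smul] at h
    exact h.symm
  · rw [neg_smul, star_neg, star_I_smul] at h
    rw [neg_smul, h, neg_neg]

lemma star_smul_of_star_I_mul {A : Type*} [NormedRing A] [StarRing A] [CStarRing A]
    [NormedAlgebra ℂ A] {ε : ℂ} (hε : ε * ε = -1) {x : A}
    (hx : star (algebraMap ℂ A Complex.I) * x = ε • x) (c : ℂ) :
    star (c • x) = ((c.re : ℂ) + c.im * ε) • star x := by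
  have hreal (r : ℝ) (y : A) : star ((r : ℂ) • y) = (r : ℂ) • star y := by
    have := map_real_smul (starAddEquiv : A ≃+ A) continuous_star r y
    simpa using this
  have hI : star (Complex.I • x) = ε • star x := by
    rw [star_I_smul, star_I_mul_star hε hx]
  conv_lhs => rw [← Complex.re_add_im c]
  rw [add_smul, star_add, hreal, mul_smul, hreal, hI, smul_smul, add_smul]

/-- The central projection onto the part of `A` on which the involution is complex linear. -/
noncomputable def linearPart (A : Type*) [Ring A] [StarRing A] [Algebra ℂ A] : A :=
  (2⁻¹ : ℂ) • (1 - Complex.I • star (algebraMap ℂ A Complex.I))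

lemma linearPart_commute {A : Type*} [Ring A] [StarRing A] [Algebra ℂ A] (x : A) :
    linearPart A * x = x * linearPart A := by
  simp only [linearPart, smul_mul_assoc, mul_smul_comm, sub_mul, mul_sub, one_mul, mul_one,
    star_I_commute]

lemma star_I_mul_linearPart {A : Type*} [Ring A] [StarRing A] [Algebra ℂ A] :
    star (algebraMap ℂ A Complex.I) * linearPart A = Complex.I • linearPart A := by
  simp only [linearPart, mul_smul_comm, mul_sub, mul_one, star_I_mul_self, smul_sub, smul_neg,
    smul_smul]
  match_scalars <;> ring_nf
  norm_num

lemma linearPart_mul_of_star_I_mul {A : Type*} [Ring A] [StarRing A] [Algebra ℂ A] {x : A}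
    (hx : star (algebraMap ℂ A Complex.I) * x = Complex.I • x) : linearPart A * x = x := by
  simp only [linearPart, smul_mul_assoc, sub_mul, one_mul, hx, smul_smul, Complex.I_mul_I]
  module

lemma star_linearPart {A : Type*} [NormedRing A] [StarRing A] [CStarRing A]
    [NormedAlgebra ℂ A] : star (linearPart A) = linearPart A := by
  have h : star (algebraMap ℂ A Complex.I) * (1 - Complex.I • star (algebraMap ℂ A Complex.I))
      = Complex.I • (1 - Complex.I • star (algebraMap ℂ A Complex.I)) := by
    simp only [mul_sub, mul_smul_comm, mul_one, star_I_mul_self, smul_sub, smul_smul,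
      Complex.I_mul_I]
    module
  rw [linearPart, star_smul_of_star_I_mul Complex.I_mul_I h, star_sub, star_one, star_I_smul,
    star_star, ← Algebra.commutes, ← Algebra.smul_def]
  norm_num

/-- Averaging over the fourth roots of unity extracts the linear coefficient of `(e + t c) ^ 4`. -/
lemma fourth_root_average {A : Type*} [Ring A] [Algebra ℂ A] {e c : A}
    (hee : e * e = e) (hec : e * c = c) (hce : c * e = c) :
    (e + (1 : ℂ) • c) ^ 4 - (e + (-1 : ℂ) • c) ^ 4
      - Complex.I • (e + Complex.I • c) ^ 4 + Complex.I • (e + (-Complex.I) • c) ^ 4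
      = (16 : ℂ) • c := by
  have h2 (t : ℂ) : (e + t • c) ^ 2 = e + (2 * t) • c + (t ^ 2) • (c * c) := by
    simp only [pow_two, mul_add, add_mul, smul_mul_assoc, mul_smul_comm, hee, hec, hce]
    module
  have h4 (t : ℂ) : (e + t • c) ^ 4 = e + (4 * t) • c + (6 * t ^ 2) • (c * c)
      + (4 * t ^ 3) • (c * (c * c)) + (t ^ 4) • (c * (c * (c * c))) := by
    have hecc : e * (c * c) = c * c := by rw [← mul_assoc, hec]
    rw [pow_mul (e + t • c) 2 2, h2, pow_two]
    simp only [mul_add, add_mul, smul_mul_assoc, mul_smul_comm, mul_assoc, hee, hec, hce, hecc]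
    module
  have hI3 : Complex.I ^ 3 = -Complex.I := Complex.I_pow_three
  simp only [h4]
  match_scalars <;> ring_nf <;> simp
  ring_nf

/-- On the complex linear part of `A` the involution is trivial. -/
lemma star_eq_self_of_star_I_mul {A : Type*} [NormedRing A] [StarRing A] [CStarRing A]
    [NormedAlgebra ℂ A] {x : A}
    (hx : star (algebraMap ℂ A Complex.I) * x = Complex.I • x) : star x = x := by
  have hlin {y : A} (hy : star (algebraMap ℂ A Complex.I) * y = Complex.I • y) (t : ℂ) :
      star (t • y) = t • star y := by
    rw [star_smul_of_star_I_mul Complex.I_mul_I hy, Complex.re_add_im]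
  have hb : star (algebraMap ℂ A Complex.I) * (x - star x) = Complex.I • (x - star x) := by
    rw [mul_sub, hx, star_I_mul_star Complex.I_mul_I hx, smul_sub]
  by_contra hne
  have hb0 : ‖x - star x‖ ≠ 0 := norm_ne_zero_iff.mpr (sub_ne_zero.mpr (Ne.symm hne))
  set r : ℂ := (((2 * ‖x - star x‖)⁻¹ : ℝ) : ℂ)
  set c : A := r • (x - star x) with hc
  have hcI : star (algebraMap ℂ A Complex.I) * c = Complex.I • c := by
    rw [hc, mul_smul_comm, hb, smul_comm]
  have hcn : ‖c‖ = 1 / 2 := by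
    rw [hc, norm_smul, Complex.norm_real, norm_inv, norm_mul, norm_norm, Real.norm_ofNat]
    field_simp
  have hcs : star c = -c := by
    rw [hc, hlin hb, star_sub, star_star, ← smul_neg, neg_sub]
  set e : A := linearPart A
  have hee : e * e = e := linearPart_mul_of_star_I_mul star_I_mul_linearPart
  have hec : e * c = c := linearPart_mul_of_star_I_mul hcI
  have hce : c * e = c := by rw [← linearPart_commute, hec]
  have hes : star e = e := star_linearPart
  have he : ‖e‖ ≤ 1 := by
    have h := CStarRing.norm_star_mul_self (x := e)
    rw [hes, hee] at h
    nlinarith [norm_nonneg e]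
  have hw (t : ℂ) (ht : ‖t‖ = 1) : ‖(e + t • c) ^ 4‖ ≤ 25 / 16 := by
    have h1 : star (e + t • c) * (e + t • c) = e - (t ^ 2) • (c * c) := by
      rw [star_add, hes, hlin hcI, hcs]
      simp only [mul_add, add_mul, smul_mul_assoc, mul_smul_comm, hee, hec, hce,
        smul_neg, neg_mul]
      module
    have h2 : ‖e + t • c‖ ^ 2 ≤ 5 / 4 := by
      rw [pow_two, ← CStarRing.norm_star_mul_self, h1]
      refine (norm_sub_le _ _).trans ?_
      rw [norm_smul, norm_pow, ht]
      have := norm_mul_le c c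
      rw [hcn] at this
      linarith
    calc ‖(e + t • c) ^ 4‖ ≤ ‖e + t • c‖ ^ 4 := norm_pow_le' _ (by norm_num)
      _ = (‖e + t • c‖ ^ 2) ^ 2 := by ring
      _ ≤ (5 / 4) ^ 2 := by gcongr
      _ = 25 / 16 := by norm_num
  have h := congrArg norm (fourth_root_average hee hec hce)
  rw [norm_smul, hcn] at h
  have h1 := hw 1 (by simp)
  have h2 := hw (-1) (by simp)
  have h3 := hw Complex.I (by simp)
  have h4 := hw (-Complex.I) (by simp)
  have h5 := norm_add_le ((e + (1 : ℂ) • c) ^ 4 - (e + (-1 : ℂ) • c) ^ 4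
      - Complex.I • (e + Complex.I • c) ^ 4) (Complex.I • (e + (-Complex.I) • c) ^ 4)
  have h6 := norm_sub_le ((e + (1 : ℂ) • c) ^ 4 - (e + (-1 : ℂ) • c) ^ 4)
      (Complex.I • (e + Complex.I • c) ^ 4)
  have h7 := norm_sub_le ((e + (1 : ℂ) • c) ^ 4) ((e + (-1 : ℂ) • c) ^ 4)
  rw [norm_smul, Complex.norm_I, one_mul] at h5 h6
  rw [Complex.norm_ofNat] at h
  linarith

/-- Commuting idempotents whose multiples `g k * h` sum to a nonpositive multiple of `h` all
annihilate `h`. -/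
lemma idempotent_mul_eq_zero_of_sum_eq_zero {ι A : Type*} [Ring A] [IsAddTorsionFree A]
    {g : ι → A} (hg : ∀ k, g k * g k = g k) (hcomm : ∀ k l, g k * g l = g l * g k)
    (s : Finset ι) (m : ℕ) (h : A) (hsum : m • h + ∑ k ∈ s, g k * h = 0) :
    m • h = 0 ∧ ∀ k ∈ s, g k * h = 0 := by
  classical
  induction s using Finset.induction_on generalizing m h with
  | empty => simpa using hsum
  | insert a s ha ih =>
    rw [Finset.sum_insert ha] at hsum
    have h1 : (m + 1) • (g a * h) + ∑ k ∈ s, g k * (g a * h) = 0 := by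
      have := congrArg (g a * ·) hsum
      simp only [mul_add, mul_zero, Finset.mul_sum, mul_smul_comm, ← mul_assoc, hg] at this
      simp only [← mul_assoc, hcomm _ a, add_smul, one_smul, add_assoc]
      exact this
    have h2 : g a * h = 0 := (smul_eq_zero.mp (ih _ _ h1).1).resolve_left (Nat.succ_ne_zero m)
    rw [h2, zero_add] at hsum
    obtain ⟨h3, h4⟩ := ih _ _ hsum
    exact ⟨h3, Finset.forall_mem_insert _ _ _ |>.mpr ⟨h2, h4⟩⟩

lemma eq_zero_of_sum_star_mul_self_eq_zero {ι B : Type*} [NonUnitalCStarAlgebra B]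
    {s : Finset ι} {x : ι → B} (h : ∑ k ∈ s, star (x k) * x k = 0) : ∀ k ∈ s, x k = 0 := by
  let _ := CStarAlgebra.spectralOrder B
  let _ := CStarAlgebra.spectralOrderedRing B
  intro k hk
  exact (CStarRing.star_mul_self_eq_zero_iff _).mp
    ((Finset.sum_eq_zero_iff_of_nonneg fun k _ ↦ star_mul_self_nonneg (x k)).mp h k hk)

/-- The part of `A` on which the involution is conjugate linear. -/
def conjLinearPart (A : Type*) [Ring A] [StarRing A] [Algebra ℂ A] :
    NonUnitalStarSubalgebra ℂ A where
  carrier := {x | star (algebraMap ℂ A Complex.I) * x = (-Complex.I) • x}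
  zero_mem' := by simp
  add_mem' := by
    intro a b ha hb
    simp only [Set.mem_ofPred_eq] at *
    rw [mul_add, ha, hb, smul_add]
  mul_mem' := by
    intro a b ha _
    simp only [Set.mem_ofPred_eq] at *
    rw [← mul_assoc, ha, smul_mul_assoc]
  smul_mem' := by
    intro c x hx
    simp only [Set.mem_ofPred_eq] at *
    rw [mul_smul_comm, hx, smul_comm]
  star_mem' := fun hx ↦ star_I_mul_star (by simp) hx

lemma isClosed_conjLinearPart (A : Type*) [NormedRing A] [StarRing A] [NormedAlgebra ℂ A] :
    IsClosed (conjLinearPart A : Set A) :=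
  isClosed_eq (continuous_const_mul _) (continuous_const_smul _)

noncomputable instance {A : Type*} [NormedRing A] [StarRing A] [CStarRing A]
    [NormedAlgebra ℂ A] [CompleteSpace A] : NonUnitalCStarAlgebra (conjLinearPart A) where
  toCompleteSpace := (isClosed_conjLinearPart A).completeSpace_coe
  norm_mul_self_le x := (CStarRing.norm_star_mul_self (x := (x : A))).symm.le
  star_smul c x := Subtype.ext <| by
    have h := star_smul_of_star_I_mul (by simp) x.2 c
    refine h.trans (congrArg (· • star (x : A)) ?_)
    apply Complex.ext <;> simp

lemma sub_linearPart_mul_mem {A : Type*} [Ring A] [StarRing A] [Algebra ℂ A] (x : A) :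
    (1 - linearPart A) * x ∈ conjLinearPart A := by
  change star (algebraMap ℂ A Complex.I) * ((1 - linearPart A) * x)
    = (-Complex.I) • ((1 - linearPart A) * x)
  rw [← mul_assoc, ← smul_mul_assoc, mul_sub, star_I_mul_linearPart]
  congr 1
  simp only [linearPart, mul_one]
  match_scalars <;> norm_num [← mul_assoc, mul_right_comm Complex.I]

/-- Projections summing to `1` are pairwise orthogonal. -/
lemma projection_mul_eq_zero {ι A : Type*} [Fintype ι] [NormedRing A] [StarRing A] [CStarRing A]
    [NormedAlgebra ℂ A] [CompleteSpace A] {p : ι → A} (hstar : ∀ i, star (p i) = p i)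
    (hidem : ∀ i, p i * p i = p i) (hsum : ∑ i, p i = 1) {i j : ι} (hij : i ≠ j) :
    p i * p j = 0 := by
  classical
  have hzero : ∑ k ∈ Finset.univ.erase j, p k * p j = 0 := by
    rw [← Finset.sum_mul, Finset.sum_erase_eq_sub (Finset.mem_univ j), hsum, sub_mul, hidem,
      one_mul, sub_self]
  have hi : i ∈ Finset.univ.erase j := Finset.mem_erase.mpr ⟨hij, Finset.mem_univ i⟩
  let _ : Module ℚ A := Module.compHom A (algebraMap ℚ ℂ)
  have : IsAddTorsionFree A := .of_module_rat A
  set e := linearPart A with he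
  have hee : e * e = e := linearPart_mul_of_star_I_mul star_I_mul_linearPart
  have hcent (x : A) : e * x = x * e := linearPart_commute x
  have hlin : e * (p i * p j) = 0 := by
    have hself (x : A) : star (e * x) = e * x := star_eq_self_of_star_I_mul <| by
      rw [← mul_assoc, star_I_mul_linearPart, smul_mul_assoc]
    have hcomm (k l : ι) : e * p k * (e * p l) = e * p l * (e * p k) := by
      have (k l : ι) : e * p k * (e * p l) = e * (p k * p l) := by
        rw [mul_assoc, ← mul_assoc (p k), ← hcent, mul_assoc, ← mul_assoc, hee]
      rw [this, this, ← hself (p k * p l), star_mul, star_mul, hstar, hstar, star_linearPart,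
        hcent]
    have := (idempotent_mul_eq_zero_of_sum_eq_zero (g := fun k ↦ e * p k)
      (fun k ↦ by
        rw [mul_assoc, ← mul_assoc (p k), ← hcent, mul_assoc, hidem, ← mul_assoc, hee]) hcomm
      (Finset.univ.erase j) 0 (p j)
      (by simp only [zero_smul, zero_add, mul_assoc, ← Finset.mul_sum, hzero, mul_zero])).2 i hi
    rwa [mul_assoc] at this
  have hconj : (1 - e) * (p i * p j) = 0 := by
    have hff : (1 - e) * (1 - e) = 1 - e := by
      rw [mul_sub, sub_mul, sub_mul, hee]
      simp
    have hfc (x : A) : (1 - e) * x = x * (1 - e) := by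
      rw [sub_mul, mul_sub, hcent, one_mul, mul_one]
    have h := eq_zero_of_sum_star_mul_self_eq_zero (s := Finset.univ.erase j)
      (x := fun k ↦ (⟨(1 - e) * (p k * p j), sub_linearPart_mul_mem _⟩ : conjLinearPart A)) (by
        apply Subtype.ext
        rw [AddSubmonoidClass.coe_finsetSum]
        have (k : ι) : star ((1 - e) * (p k * p j)) * ((1 - e) * (p k * p j))
            = (1 - e) * p j * (p k * p j) := by
          rw [star_mul, star_mul, hstar, hstar, star_sub, star_one, star_linearPart, ← he,
            mul_assoc, ← mul_assoc (1 - e), hff, ← mul_assoc, ← hfc]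
          simp only [mul_assoc]
          rw [← mul_assoc (p k), hidem]
        refine (Finset.sum_congr rfl fun k _ ↦ this k).trans ?_
        rw [← Finset.mul_sum, hzero, mul_zero]
        rfl) i hi
    exact congrArg Subtype.val h
  rw [← one_mul (p i * p j), ← add_sub_cancel e 1, add_mul, hlin, hconj, add_zero]

/-- A matrix with rows summing to `1` whose nonzero products respect adjacency transports walks
to walks of the same length. -/
lemma SimpleGraph.Walk.exists_walk_of_mul_ne_zero {V A : Type*} [Fintype V] [Ring A]
    {G : SimpleGraph V} {u : V → V → A} (hsum : ∀ a, ∑ b, u a b = 1)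
    (hrow : ∀ a b c, b ≠ c → u a b * u a c = 0)
    (hadj : ∀ a b c d, u a b * u c d ≠ 0 → (G.Adj a c ↔ G.Adj b d))
    {a c : V} (P : G.Walk a c) (b d : V) (h : u a b * u c d ≠ 0) :
    ∃ Q : G.Walk b d, Q.length = P.length := by
  induction P generalizing b with
  | nil =>
    obtain rfl : b = d := by
      by_contra hne
      exact h (hrow _ _ _ hne)
    exact ⟨.nil, rfl⟩
  | @cons a x c hax P ih =>
    rw [← one_mul (u c d), ← hsum x, Finset.sum_mul, Finset.mul_sum] at h
    obtain ⟨y, -, hy⟩ := Finset.exists_ne_zero_of_sum_ne_zero h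
    obtain ⟨Q, hQ⟩ := ih y (right_ne_zero_of_mul hy)
    rw [← mul_assoc] at hy
    have hby := (hadj a b x y (left_ne_zero_of_mul hy)).mp hax
    exact ⟨.cons hby Q, by simp [hQ]⟩

/-- Lemma 4.3: let `u` be a magic unitary over a unital C*-algebra commuting with the
adjacency matrix of a finite simple graph `G`. If there is a vertex `p` at distance `k`
from `v` whose degree differs from the degree of every vertex at distance `k` from `w`,
then `u_{vw} = 0`. -/
theorem degreeAtDistanceObstruction
    {V A : Type*} [Fintype V] [DecidableEq V]
    [NormedRing A] [StarRing A] [CStarRing A] [NormedAlgebra ℂ A] [CompleteSpace A]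
    (G : SimpleGraph V) [DecidableRel G.Adj]
    (u : V → V → A) (hmu : IsMagicUnitary u)
    (hcomm : ∀ v w : V,
      (∑ x, (if G.Adj v x then (1 : A) else 0) * u x w)
        = ∑ x, u v x * (if G.Adj x w then (1 : A) else 0))
    (v w : V) (k : ℕ) (p : V) (hp : G.edist v p = (k : ℕ∞))
    (hdeg : ∀ q : V, G.edist w q = (k : ℕ∞) → G.degree p ≠ G.degree q) :
    u v w = 0 := by
  have hrow := fun a b c (h : b ≠ c) ↦
    projection_mul_eq_zero (fun j ↦ hmu.1 a j) (fun j ↦ hmu.2.1 a j) (hmu.2.2.1 a) h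
  have hcol := fun a b c (h : b ≠ c) ↦
    projection_mul_eq_zero (fun i ↦ hmu.1 i a) (fun i ↦ hmu.2.1 i a) (hmu.2.2.2 a) h
  have hadj (a b c d : V) (h : ¬(G.Adj a c ↔ G.Adj b d)) : u a b * u c d = 0 := by
    have h1 : u a b * (∑ x, (if G.Adj a x then (1 : A) else 0) * u x d) * u c d
        = if G.Adj a c then u a b * u c d else 0 := by
      rw [mul_assoc, Finset.sum_mul, Finset.sum_eq_single c]
      · split_ifs <;> simp [hmu.2.1]
      · intro x _ hx
        rw [mul_assoc, hcol d x c hx, mul_zero]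
      · simp
    have h2 : u a b * (∑ x, u a x * (if G.Adj x d then (1 : A) else 0)) * u c d
        = if G.Adj b d then u a b * u c d else 0 := by
      rw [Finset.mul_sum, Finset.sum_eq_single b]
      · rw [← mul_assoc, hmu.2.1]
        split_ifs <;> simp
      · intro x _ hx
        rw [← mul_assoc, hrow a b x hx.symm, zero_mul]
      · simp
    have h3 := h1.symm.trans ((congrArg (fun z ↦ u a b * z * u c d) (hcomm a d)).trans h2)
    by_cases ha : G.Adj a c <;> by_cases hb : G.Adj b d <;> simp_all
  have hdegree (a b : V) (h : G.degree a ≠ G.degree b) : u a b = 0 := by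
    have h1 : ∑ x, ∑ y, (if G.Adj x y then (1 : A) else 0) * u y b
        = ∑ y, (G.degree y : A) * u y b := by
      rw [Finset.sum_comm]
      refine Finset.sum_congr rfl fun y _ ↦ ?_
      rw [← Finset.sum_mul, Finset.sum_boole]
      simp_rw [G.adj_comm _ y, ← G.card_neighborFinset_eq_degree, G.neighborFinset_eq_filter]
    have h2 : ∑ x, ∑ y, u x y * (if G.Adj y b then (1 : A) else 0) = (G.degree b : A) := by
      rw [Finset.sum_comm]
      simp_rw [← Finset.sum_mul, hmu.2.2.2, one_mul, Finset.sum_boole, G.adj_comm _ b,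
        ← G.card_neighborFinset_eq_degree, G.neighborFinset_eq_filter]
    have h3 : ∑ y, (G.degree y : A) * u y b = (G.degree b : A) := by
      rw [← h1, ← h2]
      exact Finset.sum_congr rfl fun x _ ↦ hcomm x b
    have h4 : (G.degree a : A) * u a b = (G.degree b : A) * u a b := by
      rw [← h3, Finset.sum_mul, Finset.sum_eq_single a]
      · rw [mul_assoc, hmu.2.1]
      · intro x _ hx
        rw [mul_assoc, hcol b x a hx, mul_zero]
      · simp
    have h5 : ((G.degree a : ℂ) - G.degree b) • u a b = 0 := by
      rw [sub_smul, Nat.cast_smul_eq_nsmul, Nat.cast_smul_eq_nsmul, nsmul_eq_mul, nsmul_eq_mul,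
        h4, sub_self]
    exact (smul_eq_zero.mp h5).resolve_left (sub_ne_zero.mpr (Nat.cast_injective.ne h))
  have hsub := fun a b c d (P : G.Walk a c) (h : u a b * u c d ≠ 0) ↦
    P.exists_walk_of_mul_ne_zero hmu.2.2.1 hrow
      (fun a b c d h' ↦ not_not.mp (mt (hadj a b c d) h')) b d h
  have hsub' := fun a b c d (P : G.Walk b d) (h : u a b * u c d ≠ 0) ↦
    P.exists_walk_of_mul_ne_zero (u := fun i j ↦ u j i) hmu.2.2.2 hcol
      (fun a b c d h' ↦ (not_not.mp (mt (hadj b a d c) h')).symm) a c h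
  rw [← mul_one (u v w), ← hmu.2.2.1 p, Finset.mul_sum]
  refine Finset.sum_eq_zero fun q _ ↦ ?_
  by_contra hne
  have hq : u p q ≠ 0 := right_ne_zero_of_mul hne
  refine hdeg q (le_antisymm ?_ ?_) (not_not.mp (mt (hdegree p q) hq))
  · obtain ⟨P, hP⟩ := G.exists_walk_of_edist_eq_coe hp
    obtain ⟨Q, hQ⟩ := hsub v w p q P hne
    rw [← hP, ← hQ]
    exact Q.edist_le
  · rw [← hp, SimpleGraph.edist_eq_sInf (u := w)]
    refine le_sInf ?_
    rintro _ ⟨Q, rfl⟩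
    obtain ⟨P, hP⟩ := hsub' v w p q Q hne
    change _ ≤ (Q.length : ℕ∞)
    rw [← hP]
    exact P.edist_le
end
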